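/- (Non-descendant invariance lemma, underlying Theorems 1 and 5: interventions do not change the distribution of non-descendants.) Let a factorized Bayesian-network model over variables V be given, admitting a topological ordering. Say that v is a descendant of t if the pair (t, v) lies in the transitive closure of the relation {(u, w) : u ∈ pa w}. Let T be a subset of V, ξ an assignment on T, and W a subset of V disjoint from T such that no element of W is a descendant of any element of T. Then for every assignment w on W, the interventional marginal on W equals the observational marginal: (P_{do(T=ξ)})_W(w) = P_W(w). -/

import Mathlib

open Finset

variable {V : Type*} [Fintype V] [DecidableEq V]
variable {S : V → Type*} [∀ v, Fintype (S v)] [∀ v, DecidableEq (S v)] [∀ v, Nonempty (S v)]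

/-- The joint pmf of a factorized Bayesian-network model:
`P(σ) = ∏ v, k v σ (σ v)`. -/
noncomputable def jointP (k : ∀ v, (∀ u, S u) → S v → NNReal) (σ : ∀ v, S v) : NNReal :=
  ∏ v, k v σ (σ v)

/-- The marginal of a pmf `p` on a finite set `W` of variables at an assignment `w`:
the sum of `p σ` over all full assignments `σ` agreeing with `w` on `W`. -/
noncomputable def marginal (p : (∀ v, S v) → NNReal) (W : Finset V) (w : ∀ v, S v) : NNReal :=
  ∑ σ : ∀ v, S v, if ∀ u ∈ W, σ u = w u then p σ else 0

/-- The interventional (truncated-factorization) pmf obtained by `do(T = ξ)`: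
`P_{do(T=ξ)}(σ) = ∏_{v ∉ T} k v σ (σ v)` if `σ` agrees with `ξ` on `T`, else `0`. -/
noncomputable def doP (k : ∀ v, (∀ u, S u) → S v → NNReal) (T : Finset V) (ξ : ∀ v, S v)
    (σ : ∀ v, S v) : NNReal :=
  if ∀ u ∈ T, σ u = ξ u then ∏ v ∈ Tᶜ, k v σ (σ v) else 0

/-- Resampling the coordinate `v` multiplies a sum over all assignments by the number of
states of `v`. -/
theorem sum_sum_update (v : V) (h : (∀ u, S u) → NNReal) :
    ∑ σ : ∀ u, S u, ∑ a : S v, h (Function.update σ v a)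
      = (∑ σ : ∀ u, S u, h σ) * Fintype.card (S v) := by
  let φ : (∀ u, S u) × S v → (∀ u, S u) × S v := fun x => (Function.update x.1 v x.2, x.1 v)
  have hφ : Function.Involutive φ := by
    rintro ⟨σ, a⟩
    simp [φ]
  have hsum : ∑ x : (∀ u, S u) × S v, h (φ x).1 = ∑ x : (∀ u, S u) × S v, h x.1 :=
    Equiv.sum_comp (hφ.toPerm φ) fun x => h x.1
  rw [Fintype.sum_prod_type, Fintype.sum_prod_type] at hsum
  simpa [φ, ← Finset.mul_sum, mul_comm _ (Fintype.card (S v) : NNReal)] using hsum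

/-- A normalized kernel at `v` can be summed out against a function not depending on `v`. -/
theorem sum_mul_kernel_mul_card (v : V) (κ : (∀ u, S u) → S v → NNReal)
    (hκ : ∀ σ a, κ (Function.update σ v a) = κ σ) (hnorm : ∀ σ, ∑ a, κ σ a = 1)
    (g : (∀ u, S u) → NNReal) (hg : ∀ σ a, g (Function.update σ v a) = g σ) :
    (∑ σ : ∀ u, S u, g σ * κ σ (σ v)) * Fintype.card (S v) = ∑ σ : ∀ u, S u, g σ := by
  rw [← sum_sum_update v fun σ => g σ * κ σ (σ v)]
  refine Finset.sum_congr rfl fun σ _ => ?_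
  simp [hκ, hg, ← Finset.mul_sum, hnorm]

/-- Kernels outside a parent-closed set `A` can be summed out, in reverse topological order,
against a function depending only on the coordinates in `A`. -/
theorem sum_mul_prod_union_mul_card (pa : V → Finset V)
    (k : ∀ v, (∀ u, S u) → S v → NNReal)
    (hloc : ∀ v (σ σ' : ∀ u, S u), (∀ u ∈ pa v, σ u = σ' u) → k v σ = k v σ')
    (hnorm : ∀ v (σ : ∀ u, S u), ∑ a : S v, k v σ a = 1)
    (ρ : V → ℕ) (hρ : ∀ u v, u ∈ pa v → ρ u < ρ v)
    (A : Finset V) (hA : ∀ v ∈ A, pa v ⊆ A)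
    (f : (∀ u, S u) → NNReal) (hf : ∀ v ∉ A, ∀ σ a, f (Function.update σ v a) = f σ)
    (B : Finset V) (hAB : Disjoint A B) :
    (∑ σ : ∀ u, S u, f σ * ∏ v ∈ A ∪ B, k v σ (σ v)) * ∏ v ∈ B, (Fintype.card (S v) : NNReal)
      = ∑ σ : ∀ u, S u, f σ * ∏ v ∈ A, k v σ (σ v) := by
  have hupd : ∀ u v, v ∉ pa u → ∀ σ a, k u (Function.update σ v a) = k u σ := by
    intro u v hv σ a
    refine hloc u _ _ fun x hx => Function.update_of_ne ?_ _ _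
    rintro rfl
    exact hv hx
  induction B using Finset.induction_on_max_value ρ with
  | empty => simp
  | insert b B hb hmax ih =>
    rw [Finset.disjoint_insert_right] at hAB
    obtain ⟨hbA, hAB⟩ := hAB
    have hbU : b ∉ A ∪ B := by simp [hbA, hb]
    have hpar : ∀ u ∈ A ∪ B, b ∉ pa u := by
      intro u hu hbu
      rcases Finset.mem_union.mp hu with hu | hu
      · exact hbA (hA u hu hbu)
      · exact (hρ b u hbu).not_ge (hmax u hu)
    have key := sum_mul_kernel_mul_card b (k b)
      (hupd b b fun h => (hρ b b h).false) (hnorm b)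
      (fun σ => f σ * ∏ v ∈ A ∪ B, k v σ (σ v)) (by
        intro σ a
        rw [hf b hbA]
        congr 1
        refine Finset.prod_congr rfl fun u hu => ?_
        rw [hupd u b (hpar u hu), Function.update_of_ne (ne_of_mem_of_not_mem hu hbU)])
    rw [← ih hAB, ← key, Finset.prod_insert hb, Finset.union_insert, ← mul_assoc]
    congr 3
    funext σ
    rw [Finset.prod_insert hbU]
    ring

/-- Marginals on a subset of a parent-closed set `A` only depend on the kernels in `A`. -/
theorem marginal_jointP_congr (pa : V → Finset V)
    (k k' : ∀ v, (∀ u, S u) → S v → NNReal)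
    (hloc : ∀ v (σ σ' : ∀ u, S u), (∀ u ∈ pa v, σ u = σ' u) → k v σ = k v σ')
    (hloc' : ∀ v (σ σ' : ∀ u, S u), (∀ u ∈ pa v, σ u = σ' u) → k' v σ = k' v σ')
    (hnorm : ∀ v (σ : ∀ u, S u), ∑ a : S v, k v σ a = 1)
    (hnorm' : ∀ v (σ : ∀ u, S u), ∑ a : S v, k' v σ a = 1)
    (ρ : V → ℕ) (hρ : ∀ u v, u ∈ pa v → ρ u < ρ v)
    (A : Finset V) (hA : ∀ v ∈ A, pa v ⊆ A) (hk : ∀ v ∈ A, k v = k' v)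
    (W : Finset V) (hW : W ⊆ A) (w : ∀ v, S v) :
    marginal (jointP k) W w = marginal (jointP k') W w := by
  let f : (∀ u, S u) → NNReal := fun σ => if ∀ u ∈ W, σ u = w u then 1 else 0
  have hf : ∀ v ∉ A, ∀ σ a, f (Function.update σ v a) = f σ := by
    intro v hv σ a
    have : ∀ u ∈ W, Function.update σ v a u = σ u := fun u hu =>
      Function.update_of_ne (ne_of_mem_of_not_mem (hW hu) hv) _ _
    exact if_congr (forall₂_congr fun u hu => by rw [this u hu]) rfl rfl
  have hmarg : ∀ κ : ∀ v, (∀ u, S u) → S v → NNReal,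
      marginal (jointP κ) W w = ∑ σ : ∀ u, S u, f σ * ∏ v ∈ A ∪ Aᶜ, κ v σ (σ v) := by
    intro κ
    simp [marginal, jointP, f]
  have hcard : ∏ v ∈ Aᶜ, (Fintype.card (S v) : NNReal) ≠ 0 :=
    Finset.prod_ne_zero_iff.mpr fun v _ => Nat.cast_ne_zero.mpr Fintype.card_ne_zero
  apply mul_right_cancel₀ hcard
  rw [hmarg, hmarg,
    sum_mul_prod_union_mul_card pa k hloc hnorm ρ hρ A hA f hf _ disjoint_compl_right,
    sum_mul_prod_union_mul_card pa k' hloc' hnorm' ρ hρ A hA f hf _ disjoint_compl_right]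
  refine Finset.sum_congr rfl fun σ _ => ?_
  congr 1
  exact Finset.prod_congr rfl fun v hv => by rw [hk v hv]

/-- The kernels of the intervened model: point masses at `ξ` on `T`, unchanged elsewhere. -/
noncomputable def doKernel (k : ∀ v, (∀ u, S u) → S v → NNReal) (T : Finset V) (ξ : ∀ v, S v) :
    ∀ v, (∀ u, S u) → S v → NNReal :=
  fun v σ a => if v ∈ T then (if a = ξ v then 1 else 0) else k v σ a

/-- The truncated factorization is the joint pmf of the intervened model. -/
theorem doP_eq_jointP_doKernel (k : ∀ v, (∀ u, S u) → S v → NNReal) (T : Finset V)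
    (ξ : ∀ v, S v) : doP k T ξ = jointP (doKernel k T ξ) := by
  funext σ
  have hT : ∏ v ∈ T, doKernel k T ξ v σ (σ v) = if ∀ u ∈ T, σ u = ξ u then 1 else 0 := by
    have hbool : ∏ v ∈ T, (if σ v = ξ v then (1 : NNReal) else 0)
        = if ∀ u ∈ T, σ u = ξ u then 1 else 0 := by
      convert Finset.prod_boole
    rw [← hbool]
    exact Finset.prod_congr rfl fun v hv => by simp [doKernel, hv]
  have hTc : ∏ v ∈ Tᶜ, doKernel k T ξ v σ (σ v) = ∏ v ∈ Tᶜ, k v σ (σ v) :=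
    Finset.prod_congr rfl fun v hv => by simp [doKernel, Finset.mem_compl.mp hv]
  rw [jointP, ← Finset.prod_mul_prod_compl T, hT, hTc, doP, ite_mul, one_mul, zero_mul]

/-- **Non-descendant invariance.** If no element of `W` is a descendant of any element
of `T` (descendant = transitive closure of the parent relation) and `W` is disjoint
from `T`, then the interventional marginal of `do(T = ξ)` on `W` equals the
observational marginal on `W`. -/
theorem intervention_nondescendant_invariance
    (pa : V → Finset V)
    (k : ∀ v, (∀ u, S u) → S v → NNReal)
    (hpa : ∀ v, v ∉ pa v)
    (hloc : ∀ v (σ σ' : ∀ u, S u), (∀ u ∈ pa v, σ u = σ' u) → k v σ = k v σ')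
    (hnorm : ∀ v (σ : ∀ u, S u), ∑ a : S v, k v σ a = 1)
    (htopo : ∃ ρ : V → ℕ, Function.Injective ρ ∧ ∀ u v, u ∈ pa v → ρ u < ρ v)
    (T W : Finset V) (hdisj : Disjoint W T)
    (hdesc : ∀ t ∈ T, ∀ v ∈ W, ¬ Relation.TransGen (fun u w => u ∈ pa w) t v)
    (ξ w : ∀ v, S v) :
    marginal (doP k T ξ) W w = marginal (jointP k) W w := by
  classical
  obtain ⟨ρ, -, hρ⟩ := htopo
  let A : Finset V := {v | ∀ t ∈ T, ¬ Relation.ReflTransGen (fun u w => u ∈ pa w) t v}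
  have hA : ∀ v ∈ A, pa v ⊆ A := by
    intro v hv u hu
    simp only [A, Finset.mem_filter_univ] at hv ⊢
    exact fun t ht h => hv t ht (h.tail hu)
  have hAT : ∀ v ∈ A, v ∉ T := by
    intro v hv hvT
    simp only [A, Finset.mem_filter_univ] at hv
    exact hv v hvT .refl
  have hWA : W ⊆ A := by
    intro v hv
    simp only [A, Finset.mem_filter_univ]
    intro t ht h
    rcases Relation.reflTransGen_iff_eq_or_transGen.mp h with rfl | h
    · exact Finset.disjoint_left.mp hdisj hv ht
    · exact hdesc t ht v hv h
  rw [doP_eq_jointP_doKernel]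
  refine marginal_jointP_congr pa _ k ?_ hloc ?_ hnorm ρ hρ A hA ?_ W hWA w
  · intro v σ σ' h
    funext a
    simp only [doKernel, hloc v σ σ' h]
  · intro v σ
    by_cases hv : v ∈ T <;> simp [doKernel, hv, hnorm]
  · intro v hv
    funext σ a
    simp [doKernel, hAT v hv]
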